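/- Every order-based semantics is continuous: if ⪯ is a suitable order, then S_⪯ is stabilizing, and for every database D, every sequence (R_i) of regular expressions whose languages L(R_i) form a non-decreasing chain, and every regular expression R_∞ with L(R_∞) = ⋃_i L(R_i), the eventual value of the sequence S_⪯(D,R_i) equals S_⪯(D,R_∞). -/

import Mathlib

namespace RPQ

/-- Vertex identifiers. -/
abbrev V : Type := ℕ
/-- Edge identifiers. -/
abbrev Edg : Type := ℕ
/-- Labels. -/
abbrev Lab : Type := ℕ

/-- A walk: a nonempty alternating sequence `v₀,e₁,v₁,…,e_k,v_k`, encoded as the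
initial vertex together with the list of (edge, next-vertex) pairs. -/
structure Walk where
  head : V
  steps : List (Edg × V)
deriving DecidableEq

namespace Walk

def length (w : Walk) : ℕ := w.steps.length
def src (w : Walk) : V := w.head
def tgt (w : Walk) : V := (w.steps.map Prod.snd).getLastD w.head
/-- The pair of endpoints of a walk. -/
def ep (w : Walk) : V × V := (w.src, w.tgt)
def vertexList (w : Walk) : List V := w.head :: w.steps.map Prod.snd
def edgeList (w : Walk) : List Edg := w.steps.map Prod.fst
/-- Concatenation of walks (meaningful when `w.tgt = w'.src`). -/
def concat (w w' : Walk) : Walk := ⟨w.head, w.steps ++ w'.steps⟩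

end Walk

/-- A graph database. -/
structure Database where
  labels : Finset Lab
  verts : Finset V
  edges : Finset Edg
  src : Edg → V
  tgt : Edg → V
  lbl : Edg → Lab
  src_mem : ∀ e ∈ edges, src e ∈ verts
  tgt_mem : ∀ e ∈ edges, tgt e ∈ verts
  lbl_mem : ∀ e ∈ edges, lbl e ∈ labels

def chainFrom (D : Database) : V → List (Edg × V) → Prop
  | _, [] => True
  | v, (e, v') :: rest =>
      e ∈ D.edges ∧ D.src e = v ∧ D.tgt e = v' ∧ chainFrom D v' rest

/-- `w` is consistent with `D`, i.e. `w` is a walk in `D`. -/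
def Walk.Consistent (D : Database) (w : Walk) : Prop :=
  w.head ∈ D.verts ∧ chainFrom D w.head w.steps

/-- The set of walks in `D`. -/
def Walks (D : Database) : Set Walk := {w | w.Consistent D}

/-- The label of a walk in `D`: the word of its successive edge labels. -/
def Walk.label (D : Database) (w : Walk) : List Lab :=
  w.steps.map fun p => D.lbl p.1

abbrev RE := RegularExpression Lab

/-- Matches of `R` in `D`: walks in `D` whose label conforms to `R`. -/
def Matches (D : Database) (R : RE) : Set Walk :=
  {w | w.Consistent D ∧ w.label D ∈ R.matches'}

/-- A semantics maps a database and a query to a finite subset of its matches. -/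
def IsSemantics (S : Database → RE → Set Walk) : Prop :=
  ∀ D R, S D R ⊆ Matches D R ∧ (S D R).Finite

/-- `S` is walk-based. -/
def WalkBased (S : Database → RE → Set Walk) : Prop :=
  ∃ r : Set Walk → Set Walk, ∀ D R, S D R = r (Matches D R)

/-- The semantics defined by a filter `f`. -/
def FilterSem (f : Walk → Bool) (D : Database) (R : RE) : Set Walk :=
  {w ∈ Matches D R | f w = true}

/-- Componentwise inclusion of databases. -/
def Database.Sub (D D' : Database) : Prop :=
  D.labels ⊆ D'.labels ∧ D.verts ⊆ D'.verts ∧ D.edges ⊆ D'.edges ∧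
    ∀ e ∈ D.edges, D'.src e = D.src e ∧ D'.tgt e = D.tgt e ∧ D'.lbl e = D.lbl e

def IsPartialOrderRel (le : Walk → Walk → Prop) : Prop :=
  (∀ w, le w w) ∧ (∀ a b c, le a b → le b c → le a c) ∧ ∀ a b, le a b → le b a → a = b

/-- `le` is a well-partial-order on the walks of `D`. -/
def IsWpoOn (le : Walk → Walk → Prop) (D : Database) : Prop :=
  ∀ f : ℕ → Walk, (∀ n, (f n).Consistent D) → ∃ i j, i < j ∧ le (f i) (f j)

/-- Suitable order: a partial order on walks that is a wpo on `Walks D` for each `D`. -/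
def Suitable (le : Walk → Walk → Prop) : Prop :=
  IsPartialOrderRel le ∧ ∀ D, IsWpoOn le D

/-- The semantics based on the order `le`: the `le`-minimal matches among those
with the same endpoints. -/
def OrderSem (le : Walk → Walk → Prop) (D : Database) (R : RE) : Set Walk :=
  {w ∈ Matches D R | ∀ w' ∈ Matches D R, w'.ep = w.ep → le w' w → w' = w}

def Monotonous (S : Database → RE → Set Walk) : Prop :=
  ∀ D D' R, D.Sub D' → S D R ⊆ S D' R

def CoMonotonous (S : Database → RE → Set Walk) : Prop :=
  ∀ D D' R, D.Sub D' → S D' R ∩ Walks D ⊆ S D R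

def Stabilizing (S : Database → RE → Set Walk) : Prop :=
  ∀ (D : Database) (Rs : ℕ → RE),
    (∀ i j, i ≤ j → ∀ u, u ∈ (Rs i).matches' → u ∈ (Rs j).matches') →
    ∃ N, ∀ n, N ≤ n → S D (Rs n) = S D (Rs N)

/-- Concatenation lifted to sets of walks. -/
def setConcat (W W' : Set Walk) : Set Walk :=
  {u | ∃ w ∈ W, ∃ w' ∈ W', w.tgt = w'.src ∧ u = w.concat w'}

/-- `setStar W` : all concatenations `w₁·…·w_k` (k ≥ 1) of walks of `W`. -/
inductive setStar (W : Set Walk) : Walk → Prop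
  | base : ∀ w ∈ W, setStar W w
  | step : ∀ u w, setStar W u → w ∈ W → u.tgt = w.src → setStar W (u.concat w)

/-- Walks jointly consistent with some database. -/
def ConsistentPair (w w' : Walk) : Prop :=
  ∃ D : Database, w.Consistent D ∧ w'.Consistent D

/-- The trimming of an order. -/
def trimRel (le : Walk → Walk → Prop) (w w' : Walk) : Prop :=
  ConsistentPair w w' ∧ w.ep = w'.ep ∧ le w w'

def Trimmed (le : Walk → Walk → Prop) : Prop := trimRel le = le

/-- `le` respects element inclusion. -/
def RespectsElemIncl (le : Walk → Walk → Prop) : Prop :=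
  ∀ w w', le w w' →
    (∀ v ∈ w.vertexList, v ∈ w'.vertexList) ∧ ∀ e ∈ w.edgeList, e ∈ w'.edgeList

/-- Action of a relabeling on a database. -/
def Database.relabel (π : Equiv.Perm Lab) (D : Database) : Database where
  labels := D.labels.image (⇑π)
  verts := D.verts
  edges := D.edges
  src := D.src
  tgt := D.tgt
  lbl := fun e => π (D.lbl e)
  src_mem := D.src_mem
  tgt_mem := D.tgt_mem
  lbl_mem := fun e he => Finset.mem_image_of_mem (⇑π) (D.lbl_mem e he)

/-- Action of a renaming on a walk. -/
def Walk.rename (νv : Equiv.Perm V) (νe : Equiv.Perm Edg) (w : Walk) : Walk :=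
  ⟨νv w.head, w.steps.map fun p => (νe p.1, νv p.2)⟩

/-- Action of a renaming on a database. -/
def Database.rename (νv : Equiv.Perm V) (νe : Equiv.Perm Edg) (D : Database) :
    Database where
  labels := D.labels
  verts := D.verts.image (⇑νv)
  edges := D.edges.image (⇑νe)
  src := fun e => νv (D.src (νe.symm e))
  tgt := fun e => νv (D.tgt (νe.symm e))
  lbl := fun e => D.lbl (νe.symm e)
  src_mem := by
    intro e he
    obtain ⟨e', he', rfl⟩ := Finset.mem_image.mp he
    simpa using Finset.mem_image_of_mem (⇑νv) (D.src_mem e' he')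
  tgt_mem := by
    intro e he
    obtain ⟨e', he', rfl⟩ := Finset.mem_image.mp he
    simpa using Finset.mem_image_of_mem (⇑νv) (D.tgt_mem e' he')
  lbl_mem := by
    intro e he
    obtain ⟨e', he', rfl⟩ := Finset.mem_image.mp he
    simpa using D.lbl_mem e' he'

/-- Identifier independence. -/
def IdIndependent (S : Database → RE → Set Walk) : Prop :=
  ∀ (νv : Equiv.Perm V) (νe : Equiv.Perm Edg) (D : Database) (R : RE),
    Walk.rename νv νe '' S D R = S (Database.rename νv νe D) R

/-- Unbounded semantics. -/
def Unbounded (S : Database → RE → Set Walk) : Prop :=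
  ∀ n : ℕ, ∃ (D : Database) (R : RE) (w : Walk), w ∈ S D R ∧ n ≤ w.length

/-- Shortest-walk semantics. -/
def Sh (D : Database) (R : RE) : Set Walk :=
  {w ∈ Matches D R | ∀ w' ∈ Matches D R, w'.ep = w.ep → w.length ≤ w'.length}

/-- The factor-inserting relation `F`. -/
def FactorIns (w w' : Walk) : Prop :=
  ∃ w₁ w₂ w₃ : Walk, w₁.tgt = w₂.src ∧ w₂.tgt = w₃.src ∧ w₁.tgt = w₃.src ∧
    w = w₁.concat w₃ ∧ w' = (w₁.concat w₂).concat w₃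

/-- The subwalk order: reflexive–transitive closure of `FactorIns`. -/
def SubwalkOrd : Walk → Walk → Prop := Relation.ReflTransGen FactorIns

theorem chainFrom_tgt_mem (D : Database) (l : List (Edg × V)) (v : V) (hv : v ∈ D.verts)
    (h : chainFrom D v l) : (l.map Prod.snd).getLastD v ∈ D.verts := by
  induction l generalizing v with
  | nil => simpa using hv
  | cons p l ih =>
    obtain ⟨he, -, ht, hl⟩ := h
    have := ih p.2 (ht ▸ D.tgt_mem _ he) hl
    rwa [List.map_cons, List.getLastD_cons]

theorem Walk.Consistent.ep_mem {D : Database} {w : Walk} (h : w.Consistent D) :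
    w.ep ∈ D.verts ×ˢ D.verts :=
  Finset.mem_product.2 ⟨h.1, chainFrom_tgt_mem D w.steps w.head h.1 h.2⟩

/-- The order `le` restricted to pairs of walks with the same endpoints. -/
def EpLe (le : Walk → Walk → Prop) (w w' : Walk) : Prop := w.ep = w'.ep ∧ le w w'

theorem IsPartialOrderRel.isPreorder_epLe {le : Walk → Walk → Prop} (h : IsPartialOrderRel le) :
    IsPreorder Walk (EpLe le) where
  refl w := ⟨rfl, h.1 w⟩
  trans _ _ _ hab hbc := ⟨hab.1.trans hbc.1, h.2.1 _ _ _ hab.2 hbc.2⟩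

theorem IsWpoOn.partiallyWellOrderedOn_epLe {le : Walk → Walk → Prop} {D : Database}
    (h : IsWpoOn le D) : (Walks D).PartiallyWellOrderedOn (EpLe le) := by
  rw [Set.partiallyWellOrderedOn_iff_exists_lt]
  intro f hf
  have hpwo : ((D.verts ×ˢ D.verts : Finset (V × V)) : Set (V × V)).PartiallyWellOrderedOn
      (· = ·) := (Finset.finite_toSet _).partiallyWellOrderedOn
  obtain ⟨g, hg⟩ := hpwo.exists_monotone_subseq (f := fun n => (f n).ep)
    fun n => (hf n).ep_mem
  obtain ⟨i, j, hij, hle⟩ := h (fun n => f (g n)) fun n => hf (g n)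
  exact ⟨g i, g j, g.strictMono hij, hg i j hij.le, hle⟩

/-- The `le`-minimal walks of `M` among those with the same endpoints. -/
def minimalWalks (le : Walk → Walk → Prop) (M : Set Walk) : Set Walk :=
  {w ∈ M | ∀ w' ∈ M, w'.ep = w.ep → le w' w → w' = w}

theorem orderSem_eq_minimalWalks (le : Walk → Walk → Prop) (D : Database) (R : RE) :
    OrderSem le D R = minimalWalks le (Matches D R) := rfl

section

variable {le : Walk → Walk → Prop} {D : Database} {M : Set Walk}

theorem Suitable.finite_minimalWalks (hle : Suitable le) (hM : M ⊆ Walks D) :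
    (minimalWalks le M).Finite := by
  have hanti : IsAntichain (EpLe le) (minimalWalks le M) :=
    fun a ha b hb hne hab => hne (hb.2 a ha.1 hab.1 hab.2)
  have := hle.1.isPreorder_epLe
  exact hanti.finite_of_partiallyWellOrderedOn
    ((hle.2 D).partiallyWellOrderedOn_epLe.mono fun w hw => hM hw.1)

theorem Suitable.exists_minimalWalks_le (hle : Suitable le) (hM : M ⊆ Walks D) {w : Walk}
    (hw : w ∈ M) : ∃ m ∈ minimalWalks le M, m.ep = w.ep ∧ le m w := by
  have := hle.1.isPreorder_epLe
  have hwf := ((hle.2 D).partiallyWellOrderedOn_epLe.mono hM).wellFoundedOn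
  refine hwf.induction (P := fun w => ∃ m ∈ minimalWalks le M, m.ep = w.ep ∧ le m w) hw fun w hw ih => ?_
  by_cases hmin : w ∈ minimalWalks le M
  · exact ⟨w, hmin, rfl, hle.1.1 w⟩
  · obtain ⟨u, hu, hep, huw, hne⟩ : ∃ u ∈ M, u.ep = w.ep ∧ le u w ∧ u ≠ w := by
      by_contra! hcon
      exact hmin ⟨hw, hcon⟩
    obtain ⟨m, hm, hmep, hmu⟩ := ih u hu
      ⟨⟨hep, huw⟩, fun hwu => hne (hle.1.2.2 _ _ huw hwu.2)⟩
    exact ⟨m, hm, hmep.trans hep, hle.1.2.1 _ _ _ hmu huw⟩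

theorem Suitable.minimalWalks_iUnion (hle : Suitable le) {M : ℕ → Set Walk} (hmono : Monotone M)
    (hM : ∀ n, M n ⊆ Walks D) :
    ∃ N, ∀ n, N ≤ n → minimalWalks le (M n) = minimalWalks le (⋃ i, M i) := by
  have hU : ⋃ i, M i ⊆ Walks D := Set.iUnion_subset hM
  obtain ⟨N, hN⟩ := hmono.directed_le.exists_mem_subset_of_finset_subset_biUnion
    (s := (hle.finite_minimalWalks hU).toFinset)
    (by rw [Set.Finite.coe_toFinset]; exact fun w hw => hw.1)
  rw [Set.Finite.coe_toFinset] at hN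
  refine ⟨N, fun n hn => Set.Subset.antisymm (fun w hw => ?_) fun w hw => ?_⟩
  · obtain ⟨m, hm, hep, hmw⟩ := hle.exists_minimalWalks_le hU (Set.mem_iUnion_of_mem n hw.1)
    exact hw.2 m (hmono hn (hN hm)) hep hmw ▸ hm
  · exact ⟨hmono hn (hN hw), fun u hu => hw.2 u (Set.mem_iUnion_of_mem n hu)⟩

end

/-- Every order-based semantics is continuous. -/
theorem every_orderBased_continuous
    (le : Walk → Walk → Prop) (hle : Suitable le) :
    Stabilizing (OrderSem le) ∧
      ∀ (D : Database) (Rs : ℕ → RE),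
        (∀ i j, i ≤ j → ∀ u, u ∈ (Rs i).matches' → u ∈ (Rs j).matches') →
        ∀ Rinf : RE, (∀ u, u ∈ Rinf.matches' ↔ ∃ i, u ∈ (Rs i).matches') →
          ∃ N, ∀ n, N ≤ n → OrderSem le D (Rs n) = OrderSem le D Rinf := by
  have key : ∀ (D : Database) (Rs : ℕ → RE),
      (∀ i j, i ≤ j → ∀ u, u ∈ (Rs i).matches' → u ∈ (Rs j).matches') →
      ∃ N, ∀ n, N ≤ n →
        OrderSem le D (Rs n) = minimalWalks le (⋃ i, Matches D (Rs i)) := fun D Rs hRs =>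
    hle.minimalWalks_iUnion (M := fun i => Matches D (Rs i))
      (fun i j hij w hw => ⟨hw.1, hRs i j hij _ hw.2⟩) fun i w hw => hw.1
  refine ⟨fun D Rs hRs => ?_, fun D Rs hRs Rinf hinf => ?_⟩
  · obtain ⟨N, hN⟩ := key D Rs hRs
    exact ⟨N, fun n hn => (hN n hn).trans (hN N le_rfl).symm⟩
  · obtain ⟨N, hN⟩ := key D Rs hRs
    have hU : ⋃ i, Matches D (Rs i) = Matches D Rinf := by
      ext w
      simp [Matches, hinf]
    exact ⟨N, fun n hn => (hN n hn).trans (by rw [hU, orderSem_eq_minimalWalks])⟩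

end RPQ
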